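/- arXiv:2601.06745 — 2 statements merged into one kernel-verified Lean document; each statement's English description precedes it below -/
import Mathlib

section
/- Let T be a bounded linear operator on a complex Hilbert space H, and let M be a proper closed subspace of H that contains the range of T. Then M is invariant under T, and σ(T) = σ(T|_M) ∪ {0}, where T|_M denotes the restriction of T to M regarded as a bounded linear operator on the Hilbert space M. -/
set_option linter.unusedSectionVars false

variable {H : Type*} [NormedAddCommGroup H] [InnerProductSpace ℂ H] [CompleteSpace H]

theorem isUnit_swap_aux {E F : Type*} [NormedAddCommGroup E] [NormedSpace ℂ E]
    [NormedAddCommGroup F] [NormedSpace ℂ F] (A : E →L[ℂ] F) (B : F →L[ℂ] E) (μ : ℂ)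
    (hμ : μ ≠ 0) (h : IsUnit (algebraMap ℂ (E →L[ℂ] E) μ - B.comp A)) :
    IsUnit (algebraMap ℂ (F →L[ℂ] F) μ - A.comp B) := by
  obtain ⟨R, h1, h2⟩ := isUnit_iff_exists.mp h
  have h1' : ∀ x, μ • R x - B (A (R x)) = x := fun x => by
    simpa [Algebra.algebraMap_eq_smul_one] using congrArg (fun f : E →L[ℂ] E => f x) h1
  have h2' : ∀ x, μ • R x - R (B (A x)) = x := fun x => by
    simpa [Algebra.algebraMap_eq_smul_one] using congrArg (fun f : E →L[ℂ] E => f x) h2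
  refine isUnit_iff_exists.mpr
    ⟨μ⁻¹ • (ContinuousLinearMap.id ℂ F + A.comp (R.comp B)), ?_, ?_⟩
  · ext x
    have h3 := congrArg A (h1' (B x))
    simp only [map_sub, map_smul] at h3
    have : μ • (x + A (R (B x))) - A (B (x + A (R (B x)))) = μ • x := by
      simp only [map_add, smul_add]
      linear_combination (norm := module) h3
    calc _ = μ⁻¹ • (μ • (x + A (R (B x))) - A (B (x + A (R (B x))))) := by
          simp [Algebra.algebraMap_eq_smul_one, smul_sub, smul_comm μ μ⁻¹]
      _ = x := by rw [this, inv_smul_smul₀ hμ]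
  · ext x
    have h3 := congrArg A (h2' (B x))
    simp only [map_sub, map_smul] at h3
    have : (μ • x - A (B x)) + A (R (B (μ • x - A (B x)))) = μ • x := by
      simp only [map_sub, map_smul]
      linear_combination (norm := module) h3
    calc _ = μ⁻¹ • ((μ • x - A (B x)) + A (R (B (μ • x - A (B x))))) := by
          simp [Algebra.algebraMap_eq_smul_one]
      _ = x := by rw [this, inv_smul_smul₀ hμ]

/-- (Rosenthal–Rosenthal) If `T` is a bounded operator on a complex Hilbert
space whose range is contained in a proper closed subspace `M`, then `M` is invariant under `T`
and `σ(T) = σ(T|_M) ∪ {0}`. -/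
theorem spectrum_eq_spectrum_restrict_union_zero
    (T : H →L[ℂ] H) (M : Submodule ℂ H) (hMc : IsClosed ((M : Set H))) (hMp : M ≠ ⊤)
    (hrange : ∀ x, T x ∈ M) :
    (∀ x ∈ M, T x ∈ M) ∧
    spectrum ℂ T =
      spectrum ℂ ((T.comp M.subtypeL).codRestrict M fun x => hrange x) ∪ {0} := by
  refine ⟨fun x _ => hrange x, ?_⟩
  ext μ
  by_cases hμ : μ = 0
  · subst hμ
    simp only [Set.union_singleton, Set.mem_insert_iff, true_or, iff_true]
    rw [spectrum.zero_mem_iff]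
    intro h
    obtain ⟨R, h1, -⟩ := isUnit_iff_exists.mp h
    apply hMp
    rw [Submodule.eq_top_iff']
    intro x
    have : T (R x) = x := by
      simpa using congrArg (fun f : H →L[ℂ] H => f x) h1
    rw [← this]; exact hrange _
  · simp only [Set.union_singleton, Set.mem_insert_iff, hμ, false_or]
    rw [spectrum.mem_iff, spectrum.mem_iff, not_iff_not]
    exact ⟨isUnit_swap_aux (T.codRestrict M hrange) M.subtypeL μ hμ,
      isUnit_swap_aux M.subtypeL (T.codRestrict M hrange) μ hμ⟩
end

section
/- Let H and H₁ be complex Hilbert spaces, let F be a proper closed subspace of H, and let Φ : H₁ → H be a linear isometry whose range is exactly F. Let T be a bounded linear operator on H whose range is contained in F, and let S be a bounded linear operator on H₁ such that T(Φx) = Φ(Sx) for all x ∈ H₁. If 0 ∈ σ(S), then σ(T) = σ(S). -/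
set_option linter.unusedSectionVars false

/-- Abstract spectral-transfer principle: if `Φ : H₁ → H` is a linear
isometry with range the proper closed subspace `F`, `T` is a bounded operator on `H` with
range contained in `F`, `S` is a bounded operator on `H₁` intertwined with `T` by `Φ`, and
`0 ∈ σ(S)`, then `σ(T) = σ(S)`. -/
theorem spectrum_transfer
    {H H₁ : Type*} [NormedAddCommGroup H] [InnerProductSpace ℂ H] [CompleteSpace H]
    [NormedAddCommGroup H₁] [InnerProductSpace ℂ H₁] [CompleteSpace H₁]
    (F : Submodule ℂ H) (hFc : IsClosed ((F : Set H))) (hFp : F ≠ ⊤)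
    (Φ : H₁ →ₗᵢ[ℂ] H) (hΦ : Set.range Φ = (F : Set H))
    (T : H →L[ℂ] H) (hT : ∀ x, T x ∈ F)
    (S : H₁ →L[ℂ] H₁) (hTS : ∀ x, T (Φ x) = Φ (S x))
    (h0 : (0 : ℂ) ∈ spectrum ℂ S) :
    spectrum ℂ T = spectrum ℂ S := by
  have memF : ∀ h, h ∈ F → ∃ x, Φ x = h := by
    intro h hh
    have h2 : h ∈ Set.range Φ := by
      rw [hΦ]
      exact hh
    exact h2
  have Fmem : ∀ x, Φ x ∈ F := by
    intro x
    have h2 : Φ x ∈ (F : Set H) := by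
      rw [← hΦ]
      exact Set.mem_range_self x
    exact h2
  ext a
  by_cases ha : a = 0
  · subst ha
    refine ⟨fun _ => h0, fun _ => ?_⟩
    rw [spectrum.mem_iff, ContinuousLinearMap.isUnit_iff_bijective]
    rintro ⟨-, hs⟩
    apply hFp
    rw [eq_top_iff]
    intro y _
    obtain ⟨x, hx⟩ := hs y
    have h3 : y = -T x := by
      rw [← hx]
      simp
    rw [h3]
    exact F.neg_mem (hT x)
  rw [spectrum.mem_iff, spectrum.mem_iff, not_iff_not,
    ContinuousLinearMap.isUnit_iff_bijective, ContinuousLinearMap.isUnit_iff_bijective]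
  have eT : ∀ x, (algebraMap ℂ (H →L[ℂ] H) a - T) x = a • x - T x := by
    intro x
    simp [Algebra.algebraMap_eq_smul_one]
  have eS : ∀ x, (algebraMap ℂ (H₁ →L[ℂ] H₁) a - S) x = a • x - S x := by
    intro x
    simp [Algebra.algebraMap_eq_smul_one]
  have key : ∀ x, (algebraMap ℂ (H →L[ℂ] H) a - T) (Φ x)
      = Φ ((algebraMap ℂ (H₁ →L[ℂ] H₁) a - S) x) := by
    intro x
    rw [eT, eS, hTS, map_sub, map_smul]
  have pull : ∀ h, (algebraMap ℂ (H →L[ℂ] H) a - T) h ∈ F → ∃ x, Φ x = h := by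
    intro h hh
    apply memF
    rw [eT] at hh
    have h4 := F.add_mem hh (hT h)
    rw [sub_add_cancel] at h4
    exact (F.smul_mem_iff ha).1 h4
  constructor
  · rintro ⟨hi, hs⟩
    refine ⟨fun x y hxy => ?_, fun y => ?_⟩
    · apply Φ.injective
      apply hi
      rw [key, key, hxy]
    · obtain ⟨h, hh⟩ := hs (Φ y)
      obtain ⟨x, rfl⟩ := pull h (by rw [hh]; exact Fmem y)
      rw [key] at hh
      exact ⟨x, Φ.injective hh⟩
  · rintro ⟨hi, hs⟩
    refine ⟨?_, fun y => ?_⟩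
    · rw [injective_iff_map_eq_zero]
      intro h hh
      obtain ⟨x, rfl⟩ := pull h (by rw [hh]; exact F.zero_mem)
      rw [key, ← map_zero Φ] at hh
      have h5 := Φ.injective hh
      rw [(injective_iff_map_eq_zero _).1 hi x h5, map_zero]
    · obtain ⟨z, hz⟩ := memF _ (hT y)
      obtain ⟨w, hw⟩ := hs z
      refine ⟨a⁻¹ • (y + Φ w), ?_⟩
      rw [map_smul, map_add, key, hw, hz, eT, sub_add_cancel, inv_smul_smul₀ ha]
end
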